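/- arXiv:1609.00987 — 3 statements merged into one kernel-verified Lean document; each statement's English description precedes it below -/
import Mathlib

section
/- For all S, σ, τ > 0, one has (S/2) · ∑_{n≥0, m≥1} ((−1)ⁿ / (n! · Γ(1 − (n − m)/2))) · (σ√τ/√2)^{n+m} = S · (Φ(σ√τ/2) − Φ(−σ√τ/2)); i.e. at-the-money forward (S = K e^{−rτ}), the double-series pricing formula for α = 2 equals the Black–Scholes at-the-money-forward call price, as a power series in the market volatility. -/
open MeasureTheory

/-- The standard normal cumulative distribution function
`Φ(x) = (2π)^(-1/2) ∫_{-∞}^x e^(-t²/2) dt`. -/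
noncomputable def stdNormalCDF (x : ℝ) : ℝ :=
  (Real.sqrt (2 * Real.pi))⁻¹ * ∫ t in Set.Iic x, Real.exp (-(t ^ 2) / 2)


lemma aux_rec (s : ℂ) : (Complex.Gamma s)⁻¹ = s * (Complex.Gamma (s+1))⁻¹ :=
  Complex.one_div_Gamma_eq_self_mul_one_div_Gamma_add_one s

lemma aux_partial (a : ℂ) (ha : a ≠ 0) (M : ℕ) :
    ∑ n ∈ Finset.range (M+1), (-1 : ℂ)^n / ((n.factorial : ℂ) * Complex.Gamma (1 + a - n))
      = (-1)^M / (a * (M.factorial : ℂ)) * (Complex.Gamma (a - M))⁻¹ := by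
  induction M with
  | zero =>
    simp only [zero_add, Finset.sum_range_one]
    have := aux_rec a
    simp only [pow_zero, Nat.factorial_zero, Nat.cast_one, one_mul, Nat.cast_zero, sub_zero, mul_one]
    rw [this, add_comm 1 a]; field_simp
  | succ M ih =>
    rw [Finset.sum_range_succ, ih]
    have h := aux_rec (a - (M+1 : ℕ))
    have e1 : a - ((M+1 : ℕ) : ℂ) + 1 = a - M := by push_cast; ring
    have e2 : 1 + a - ((M+1 : ℕ) : ℂ) = a - M := by push_cast; ring
    rw [e1] at h
    rw [e2, h, Nat.factorial_succ, div_eq_mul_inv _ (_ * Complex.Gamma _), mul_inv]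
    have hM : (M.factorial : ℂ) ≠ 0 := by exact_mod_cast M.factorial_ne_zero
    have hM1 : (M : ℂ) + 1 ≠ 0 := by exact_mod_cast M.succ_ne_zero
    push_cast
    field_simp
    ring

lemma aux_half (k : ℕ) : (Complex.Gamma (1/2 - k))⁻¹
    = (-1)^k * ((2*k).factorial : ℂ) / (4^k * (k.factorial : ℂ) * (Real.sqrt Real.pi : ℂ)) := by
  induction k with
  | zero =>
    have : Complex.Gamma (1/2) = (Real.sqrt Real.pi : ℂ) := by
      rw [Complex.Gamma_one_half_eq, Real.sqrt_eq_rpow, Complex.ofReal_cpow Real.pi_pos.le]; simp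
    simp [← this]
  | succ k ih =>
    have h := aux_rec (1/2 - (k+1 : ℕ))
    have e1 : (1/2 : ℂ) - ((k+1 : ℕ) : ℂ) + 1 = 1/2 - k := by push_cast; ring
    rw [e1, ih] at h
    rw [h, show 2*(k+1) = 2*k+1+1 by ring, Nat.factorial_succ, Nat.factorial_succ, Nat.factorial_succ]
    have hM : (k.factorial : ℂ) ≠ 0 := by exact_mod_cast k.factorial_ne_zero
    have hM1 : (k : ℂ) + 1 ≠ 0 := by exact_mod_cast k.succ_ne_zero
    have hpi : (Real.sqrt Real.pi : ℂ) ≠ 0 := by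
      exact_mod_cast (Real.sqrt_pos.mpr Real.pi_pos).ne'
    push_cast
    field_simp
    ring

lemma aux_bound : ∃ C : ℝ, 0 ≤ C ∧ ∀ j : ℕ,
    ‖(Complex.Gamma (1 + (j : ℂ)/2))⁻¹‖ * ((j/2).factorial : ℝ) ≤ C ∧
    ‖(Complex.Gamma (1 - (j : ℂ)/2))⁻¹‖ ≤ C * ((j/2).factorial : ℝ) := by
  let g : ℂ → ℝ := fun s => ‖(Complex.Gamma s)⁻¹‖
  have hg : ∀ s, 0 ≤ g s := fun s => norm_nonneg _
  have grec : ∀ s, g s = ‖s‖ * g (s+1) := fun s => by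
    simp only [g]; rw [aux_rec s, norm_mul]
  refine ⟨g 1 + g (1 + 1/2) + g (1 - 1/2), by linarith [hg 1, hg (1+1/2), hg (1-1/2)], ?_⟩
  set C := g 1 + g (1 + 1/2) + g (1 - 1/2) with hC
  have key : ∀ j : ℕ, g (1 + (j : ℂ)/2) * ((j/2).factorial : ℝ) ≤ C ∧
    g (1 - (j : ℂ)/2) ≤ C * ((j/2).factorial : ℝ) := by
    intro j
    induction j using Nat.twoStepInduction with
    | zero => simp [hC]; linarith [hg 1, hg (1+2⁻¹), hg (1-2⁻¹)]
    | one => simp [hC]; constructor <;> linarith [hg 1, hg (1+2⁻¹), hg (1-2⁻¹)]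
    | more j ih _ =>
      obtain ⟨h1, h2⟩ := ih
      have hd : (j+2)/2 = j/2+1 := by omega
      rw [hd, Nat.factorial_succ]
      push_cast
      have hfl : ((j/2 : ℕ) : ℝ) ≤ (j:ℝ)/2 := Nat.cast_div_le
      have hfu : (j:ℝ)/2 ≤ ((j/2 : ℕ) : ℝ) + 1 := by
        have : j ≤ 2*(j/2)+2 := by omega
        have : (j:ℝ) ≤ 2*((j/2:ℕ):ℝ)+2 := by exact_mod_cast this
        linarith
      have hfp : (0:ℝ) < ((j/2).factorial : ℝ) := by exact_mod_cast Nat.factorial_pos _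
      constructor
      · have e := grec (1 + (j:ℂ)/2)
        have n1 : ‖1 + (j:ℂ)/2‖ = 1 + (j:ℝ)/2 := by
          have : (1 + (j:ℂ)/2) = ((1 + (j:ℝ)/2 : ℝ) : ℂ) := by push_cast; ring
          rw [this, Complex.norm_real, Real.norm_of_nonneg (by positivity)]
        rw [n1] at e
        rw [e] at h1
        have e2 : (1 + ((j:ℂ)+2)/2) = 1 + (j:ℂ)/2 + 1 := by ring
        rw [e2]
        refine le_trans ?_ h1
        have := hg (1 + (j:ℂ)/2 + 1)
        calc _ = (((j/2 : ℕ) : ℝ) + 1) * (g (1 + (j:ℂ)/2 + 1) * ((j/2).factorial : ℝ)) := by ring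
          _ ≤ (1 + (j:ℝ)/2) * (g (1 + (j:ℂ)/2 + 1) * ((j/2).factorial : ℝ)) := by
            have h0 : ((j/2 : ℕ) : ℝ) + 1 ≤ 1 + (j:ℝ)/2 := by linarith
            exact mul_le_mul_of_nonneg_right h0 (by positivity)
          _ = _ := by ring
      · have e := grec (1 - ((j:ℂ)+2)/2)
        have e2 : (1 - ((j:ℂ)+2)/2) = -(((j:ℝ)/2 : ℝ):ℂ) := by push_cast; ring
        have e3 : (1 - ((j:ℂ)+2)/2) + 1 = 1 - (j:ℂ)/2 := by ring
        have n1 : ‖(1 - ((j:ℂ)+2)/2)‖ = (j:ℝ)/2 := by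
          rw [e2, norm_neg, Complex.norm_real, Real.norm_of_nonneg (by positivity)]
        rw [n1, e3] at e
        rw [e]
        calc (j:ℝ)/2 * g (1 - (j:ℂ)/2) ≤ (((j/2 : ℕ) : ℝ) + 1) * (C * ((j/2).factorial : ℝ)) := by
              apply mul_le_mul hfu h2 (hg _) (by positivity)
          _ = _ := by ring
  exact key

lemma aux_fact (k h : ℕ) : ((k+h).factorial : ℝ) ≤ 2^(k+h) * (k.factorial * h.factorial) := by
  have h1 := Nat.add_choose_mul_factorial_mul_factorial k h
  have h2 := Nat.choose_le_two_pow (k+h) h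
  have : (k+h).factorial ≤ 2^(k+h) * (k.factorial * h.factorial) := by
    rw [← h1, mul_assoc]
    exact Nat.mul_le_mul_right _ h2
  exact_mod_cast this

lemma aux_coef : ∃ C : ℝ, 0 ≤ C ∧ ∀ n m : ℕ,
    ‖((n.factorial : ℂ) * Complex.Gamma (1 - ((n : ℂ) - m)/2))⁻¹‖ * (((n+m)/2).factorial : ℝ)
      ≤ C * 2^((n+m)/2) := by
  obtain ⟨C, hC, hb⟩ := aux_bound
  refine ⟨C, hC, fun n m => ?_⟩
  rw [mul_inv, norm_mul, norm_inv, Complex.norm_natCast]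
  have hfp : ∀ i : ℕ, (0:ℝ) < (i.factorial : ℝ) := fun i => by exact_mod_cast Nat.factorial_pos _
  rcases le_total n m with h | h
  · obtain ⟨j, rfl⟩ := Nat.exists_eq_add_of_le h
    have e : (1 - ((n:ℂ) - ((n+j : ℕ):ℂ))/2) = 1 + (j:ℂ)/2 := by push_cast; ring
    rw [e, show (n + (n+j))/2 = n + j/2 by omega]
    have := (hb j).1
    set G := ‖(Complex.Gamma (1 + (j : ℂ)/2))⁻¹‖
    calc _ ≤ (n.factorial:ℝ)⁻¹ * G * (2^(n+j/2) * (n.factorial * (j/2).factorial)) := by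
          gcongr; exact aux_fact _ _
      _ = (G * (j/2).factorial) * 2^(n+j/2) := by
          have := (hfp n).ne'
          field_simp
      _ ≤ _ := by gcongr
  · obtain ⟨j, rfl⟩ := Nat.exists_eq_add_of_le h
    have e : (1 - (((m+j : ℕ):ℂ) - (m:ℂ))/2) = 1 - (j:ℂ)/2 := by push_cast; ring
    rw [e, show ((m+j) + m)/2 = m + j/2 by omega]
    have := (hb j).2
    set G := ‖(Complex.Gamma (1 - (j : ℂ)/2))⁻¹‖
    have f1 : m.factorial * ((j/2).factorial * (j/2).factorial) ≤ (m+j).factorial := by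
      calc _ ≤ m.factorial * j.factorial := by
            apply Nat.mul_le_mul_left
            refine le_trans (Nat.le_of_dvd (Nat.factorial_pos _) (Nat.factorial_mul_factorial_dvd_factorial_add _ _)) ?_
            exact Nat.factorial_le (by omega)
        _ ≤ _ := Nat.le_of_dvd (Nat.factorial_pos _) (Nat.factorial_mul_factorial_dvd_factorial_add _ _)
    have f2 : (m.factorial : ℝ) * ((j/2).factorial * (j/2).factorial) ≤ (m+j).factorial := by
      exact_mod_cast f1
    calc _ ≤ ((m+j).factorial:ℝ)⁻¹ * (C * (j/2).factorial) *
            (2^(m+j/2) * (m.factorial * (j/2).factorial)) := by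
          gcongr; exact aux_fact _ _
      _ = ((m+j).factorial:ℝ)⁻¹ * (m.factorial * ((j/2).factorial * (j/2).factorial)) *
            (C * 2^(m+j/2)) := by ring
      _ ≤ ((m+j).factorial:ℝ)⁻¹ * ((m+j).factorial:ℝ) * (C * 2^(m+j/2)) := by gcongr
      _ = _ := by rw [inv_mul_cancel₀ (hfp _).ne', one_mul]

lemma aux_pow (z : ℝ) (hz : 0 ≤ z) (N : ℕ) :
    z^N * 2^(N/2) / ((N/2).factorial : ℝ)
      ≤ ((2*z+1) * Real.exp (2*(2*z+1)^2)) * (1/2)^N := by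
  have h1 : (2*z)^N ≤ (2*z+1)^(2*(N/2)+1) := by
    calc (2*z)^N ≤ (2*z+1)^N := by gcongr; linarith
      _ ≤ _ := pow_le_pow_right₀ (by linarith) (by omega)
  have h2 := Real.pow_div_factorial_le_exp (2*(2*z+1)^2) (by positivity) (N/2)
  have : (2*z)^N * 2^(N/2) / ((N/2).factorial : ℝ) ≤ (2*z+1) * Real.exp (2*(2*z+1)^2) := by
    calc _ ≤ (2*z+1)^(2*(N/2)+1) * 2^(N/2) / ((N/2).factorial : ℝ) := by gcongr
      _ = (2*z+1) * ((2*(2*z+1)^2)^(N/2) / ((N/2).factorial : ℝ)) := by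
        rw [pow_succ, pow_mul, mul_pow]; ring
      _ ≤ _ := by gcongr
  calc _ = ((2*z)^N * 2^(N/2) / ((N/2).factorial : ℝ)) * (1/2)^N := by
        rw [mul_pow, one_div, inv_pow]; field_simp
    _ ≤ _ := by gcongr

lemma aux_summable (z : ℝ) (hz : 0 ≤ z) : Summable (fun p : ℕ × ℕ =>
          ((-1 : ℂ) ^ p.1 /
              ((p.1.factorial : ℂ) *
                Complex.Gamma (1 - ((p.1 : ℂ) - ((p.2 : ℂ) + 1)) / 2))) *
            (z : ℂ) ^ (p.1 + (p.2 + 1))) := by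
  obtain ⟨C, hC, hb⟩ := aux_coef
  set D := C * ((2*z+1) * Real.exp (2*(2*z+1)^2)) with hD
  have hg : Summable (fun n : ℕ => ((1:ℝ)/2)^n) := summable_geometric_two
  have hs : Summable (fun p : ℕ × ℕ => D * (((1:ℝ)/2)^p.1 * (1/2)^p.2)) :=
    (hg.mul_of_nonneg hg (fun _ => by positivity) (fun _ => by positivity)).mul_left D
  refine Summable.of_norm_bounded hs ?_
  rintro ⟨n, m⟩
  have h := hb n (m+1)
  push_cast at h
  simp only
  rw [div_eq_mul_inv, norm_mul, norm_mul, norm_pow, norm_neg, norm_one, one_pow, one_mul, norm_pow,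
    Complex.norm_real, Real.norm_of_nonneg hz]
  set G := ‖((n.factorial : ℂ) * Complex.Gamma (1 - ((n : ℂ) - ((m:ℂ)+1))/2))⁻¹‖
  have hp := aux_pow z hz (n+(m+1))
  set N := n+(m+1) with hN
  have hfp : (0:ℝ) < ((N/2).factorial : ℝ) := by exact_mod_cast Nat.factorial_pos _
  rw [← le_div_iff₀ hfp] at h
  calc G * z^N ≤ (C * 2^(N/2) / (N/2).factorial) * z^N := by gcongr
    _ = C * (z^N * 2^(N/2) / (N/2).factorial) := by ring
    _ ≤ C * (((2*z+1) * Real.exp (2*(2*z+1)^2)) * (1/2)^N) := by gcongr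
    _ = D * (1/2)^N := by ring
    _ ≤ D * ((1/2)^(n+m)) := by
      gcongr ?_ * ?_
      exact pow_le_pow_of_le_one (by norm_num) (by norm_num) (by omega)
    _ = _ := by rw [pow_add]

lemma aux_coefN (M : ℕ) :
    ∑ n ∈ Finset.range (M+1), (-1 : ℂ)^n / ((n.factorial : ℂ) * Complex.Gamma (1 + ((M:ℂ)+1)/2 - n))
      = (-1)^M / (((M:ℂ)+1)/2 * (M.factorial : ℂ)) * (Complex.Gamma (((M:ℂ)+1)/2 - M))⁻¹ := by
  apply aux_partial
  have : (M : ℂ) + 1 ≠ 0 := by exact_mod_cast M.succ_ne_zero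
  simpa using this

lemma aux_tsum (z : ℝ) (hz : 0 ≤ z) : (∑' p : ℕ × ℕ,
          ((-1 : ℂ) ^ p.1 /
              ((p.1.factorial : ℂ) *
                Complex.Gamma (1 - ((p.1 : ℂ) - ((p.2 : ℂ) + 1)) / 2))) *
            (z : ℂ) ^ (p.1 + (p.2 + 1)))
    = ∑' k : ℕ, ((2 * (-1)^k * z^(2*k+1) / ((2*k+1) * 4^k * k.factorial * Real.sqrt Real.pi) : ℝ) : ℂ) := by
  have hs := aux_summable z hz
  set f := (fun p : ℕ × ℕ =>
          ((-1 : ℂ) ^ p.1 /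
              ((p.1.factorial : ℂ) *
                Complex.Gamma (1 - ((p.1 : ℂ) - ((p.2 : ℂ) + 1)) / 2))) *
            (z : ℂ) ^ (p.1 + (p.2 + 1))) with hf
  have hs' : Summable (f ∘ (Finset.HasAntidiagonal.sigmaAntidiagonalEquivProd (A := ℕ))) :=
    (Equiv.summable_iff _).mpr hs
  have e1 : ∑' p, f p = ∑' M : ℕ, ∑ p ∈ Finset.HasAntidiagonal.antidiagonal M, f p := by
    rw [← (Finset.HasAntidiagonal.sigmaAntidiagonalEquivProd (A := ℕ)).tsum_eq f]
    refine (hs'.tsum_sigma' (fun n => (hasSum_fintype _).summable)).trans ?_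
    refine tsum_congr fun M => ?_
    rw [tsum_fintype]
    exact Finset.sum_coe_sort (Finset.HasAntidiagonal.antidiagonal M) f
  have e2 : ∀ M : ℕ, ∑ p ∈ Finset.HasAntidiagonal.antidiagonal M, f p =
      (-1)^M / (((M:ℂ)+1)/2 * (M.factorial : ℂ)) * (Complex.Gamma (((M:ℂ)+1)/2 - M))⁻¹ * z^(M+1) := by
    intro M
    rw [← aux_coefN, Finset.Nat.sum_antidiagonal_eq_sum_range_succ_mk, Finset.sum_mul]
    refine Finset.sum_congr rfl fun n hn => ?_
    have hn' : n ≤ M := by simpa [Nat.lt_succ_iff] using hn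
    simp only [hf]
    rw [show n + (M - n + 1) = M+1 by omega, Nat.cast_sub hn']
    congr 4
    ring
  change ∑' p, f p = _
  rw [e1]
  simp_rw [e2]
  have hinj : Function.Injective (fun k : ℕ => 2*k) := fun a b h => by simpa using h
  rw [← hinj.tsum_eq]
  · refine tsum_congr fun k => ?_
    have e : (((2*k : ℕ):ℂ)+1)/2 - ((2*k:ℕ):ℂ) = 1/2 - k := by push_cast; ring
    rw [e, aux_half]
    have h1 : ((2*k).factorial : ℂ) ≠ 0 := by exact_mod_cast (2*k).factorial_ne_zero
    have hM : (k.factorial : ℂ) ≠ 0 := by exact_mod_cast k.factorial_ne_zero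
    have hM1 : 2*(k : ℂ) + 1 ≠ 0 := by exact_mod_cast (2*k).succ_ne_zero
    have hpi : (Real.sqrt Real.pi : ℂ) ≠ 0 := by
      exact_mod_cast (Real.sqrt_pos.mpr Real.pi_pos).ne'
    push_cast
    rw [pow_mul (-1:ℂ) 2 k]
    field_simp
    simp
  · intro M hM
    by_contra hne
    apply hM
    have hodd : Odd M := by
      rw [← Nat.not_even_iff_odd]
      rintro ⟨k, rfl⟩
      exact hne ⟨k, by simp; ring⟩
    obtain ⟨k, rfl⟩ := hodd
    have e : (((2*k+1 : ℕ):ℂ)+1)/2 - ((2*k+1:ℕ):ℂ) = -(k:ℂ) := by push_cast; ring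
    simp only []
    rw [e, Complex.Gamma_neg_nat_eq_zero]
    simp

lemma aux_int (x : ℝ) : HasSum (fun k : ℕ => (-1:ℝ)^k * (2*x^(2*k+1)) / ((2*k+1) * 2^k * k.factorial))
    (∫ t in (-x)..x, Real.exp (-(t^2)/2)) := by
  let F : ℕ → C(ℝ, ℝ) := fun k => ⟨fun t => (-(t^2)/2)^k / k.factorial, by fun_prop⟩
  have hval : ∀ k : ℕ, ∫ t in (-x)..x, F k t =
      (-1:ℝ)^k * (2*x^(2*k+1)) / ((2*k+1) * 2^k * k.factorial) := by
    intro k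
    have : ∀ t, F k t = ((-1)^k / (2^k * k.factorial)) * t^(2*k) := by
      intro t
      simp only [F, ContinuousMap.coe_mk]
      rw [div_pow, neg_pow, ← pow_mul]; field_simp
    simp_rw [this]
    rw [intervalIntegral.integral_const_mul, integral_pow, Odd.neg_pow ⟨k, rfl⟩]
    push_cast
    field_simp
    ring
  have hsum := intervalIntegral.hasSum_intervalIntegral_of_summable_norm (a := -x) (b := x) (f := F) ?_
  · simp_rw [hval] at hsum
    have hI : (∫ t in (-x)..x, Real.exp (-(t^2)/2)) = ∫ t in (-x)..x, ∑' i, F i t := ?_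
    · rw [hI]; exact hsum
    apply intervalIntegral.integral_congr
    intro t _
    simp only [F, ContinuousMap.coe_mk]
    rw [Real.exp_eq_exp_ℝ, NormedSpace.exp_eq_tsum_div]
  · refine Summable.of_nonneg_of_le (fun _ => norm_nonneg _) (fun k => ?_) (Real.summable_pow_div_factorial (x^2/2))
    rw [ContinuousMap.norm_le _ (by positivity)]
    rintro ⟨t, ht⟩
    have ht2 : t^2 ≤ x^2 := by
      apply sq_le_sq.mpr
      have : t ∈ Set.uIcc (-x) x := ht
      rw [Set.mem_uIcc] at this
      rcases this with h | h
      · exact (abs_le.mpr h).trans (le_abs_self x)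
      · rw [← abs_neg x]; refine (abs_le.mpr ⟨by linarith, by linarith⟩ : |t| ≤ -x).trans (le_abs_self _)
    simp only [F, ContinuousMap.restrict_apply, ContinuousMap.coe_mk]
    rw [norm_div, norm_pow, norm_div, norm_neg, norm_pow]
    simp only [Real.norm_eq_abs, sq_abs, Nat.abs_cast, Nat.abs_ofNat]
    gcongr

lemma aux_cdf (x : ℝ) : stdNormalCDF x - stdNormalCDF (-x) =
    (Real.sqrt (2 * Real.pi))⁻¹ * ∫ t in (-x)..x, Real.exp (-(t^2)/2) := by
  have hint : Integrable (fun t : ℝ => Real.exp (-(t^2)/2)) := by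
    have := integrable_exp_neg_mul_sq (b := 1/2) (by norm_num)
    refine this.congr (Filter.Eventually.of_forall fun t => ?_)
    simp only []
    congr 1; ring
  unfold stdNormalCDF
  rw [← mul_sub, intervalIntegral.integral_Iic_sub_Iic hint.integrableOn hint.integrableOn]

/-- At-the-money forward (`S = K e^(-rτ)`), the double-series pricing
formula for `α = 2` equals the Black–Scholes ATM-forward call price:
`(S/2) ∑_{n≥0,m≥1} ((-1)ⁿ/(n! Γ(1-(n-m)/2))) (σ√τ/√2)^(n+m)
 = S (Φ(σ√τ/2) - Φ(-σ√τ/2))`. -/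
theorem stmt_10 (S σ τ : ℝ) (hS : 0 < S) (hσ : 0 < σ) (hτ : 0 < τ) :
    ((S / 2 : ℝ) : ℂ) *
        ∑' p : ℕ × ℕ,
          ((-1 : ℂ) ^ p.1 /
              ((p.1.factorial : ℂ) *
                Complex.Gamma (1 - ((p.1 : ℂ) - ((p.2 : ℂ) + 1)) / 2))) *
            ((σ * Real.sqrt τ / Real.sqrt 2 : ℝ) : ℂ) ^ (p.1 + (p.2 + 1)) =
      ((S * (stdNormalCDF (σ * Real.sqrt τ / 2) -
          stdNormalCDF (-(σ * Real.sqrt τ) / 2)) : ℝ) : ℂ) := by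

  have hz : 0 ≤ σ * Real.sqrt τ / Real.sqrt 2 := by positivity
  rw [aux_tsum _ hz, neg_div, aux_cdf, ← (aux_int _).tsum_eq, ← Complex.ofReal_tsum,
    ← Complex.ofReal_mul]
  congr 1
  rw [← tsum_mul_left, ← tsum_mul_left, ← tsum_mul_left]
  refine tsum_congr fun k => ?_
  set y := σ * Real.sqrt τ
  have h2 : Real.sqrt 2 ^ 2 = 2 := Real.sq_sqrt (by norm_num)
  have h2' : Real.sqrt 2 ≠ 0 := by positivity
  have hpi : Real.sqrt Real.pi ≠ 0 := (Real.sqrt_pos.mpr Real.pi_pos).ne'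
  rw [Real.sqrt_mul (by norm_num), div_pow, div_pow, pow_succ (Real.sqrt 2), pow_mul, h2,
    pow_succ (2:ℝ) (2*k), pow_mul (2:ℝ) 2 k, show ((2:ℝ)^2) = 4 by norm_num]
  field_simp
end

section
/- For every real X ≠ 0 and every real c ∈ (0, 1), writing s = c + iu, the function u ↦ (Γ(1 − s)/Γ(1 − s/2)) · |X|^{s−1} is Lebesgue integrable on ℝ and (1/2) · (1/(2π)) ∫_ℝ (Γ(1 − s)/Γ(1 − s/2)) · |X|^{s−1} du = (1/(2√π)) · e^{−X²/4}; i.e. the Mellin–Barnes representation of the Green function for α = 2 evaluates to the Gaussian (heat) kernel. -/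
open MeasureTheory

lemma aux_norm_Gamma_le {z : ℂ} (hz : 0 < z.re) : ‖Complex.Gamma z‖ ≤ Real.Gamma z.re := by
  rw [Complex.Gamma_eq_integral hz, Real.Gamma_eq_integral hz, Complex.GammaIntegral]
  refine (norm_integral_le_integral_norm _).trans (le_of_eq ?_)
  refine setIntegral_congr_fun measurableSet_Ioi fun x hx => ?_
  have hx' : (0 : ℝ) < x := hx
  simp only [norm_mul]
  rw [Complex.norm_cpow_eq_rpow_re_of_pos hx', Complex.norm_real, Real.norm_eq_abs, Real.abs_exp]
  simp

lemma aux_Gamma_bound {σ : ℝ} (h0 : 0 < σ) (h1 : σ < 1) (v : ℝ) :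
    ‖Complex.Gamma (σ + v * Complex.I)‖ ≤ Real.Gamma (σ + 2) / σ * (1 + v ^ 2)⁻¹ := by
  set w : ℂ := σ + v * Complex.I with hw
  have hre : w.re = σ := by simp [hw]
  have him : w.im = v := by simp [hw]
  have hw0 : w ≠ 0 := by
    intro h
    rw [h] at hre
    simp at hre
    linarith
  have hw1 : w + 1 ≠ 0 := by
    intro h
    have := congrArg Complex.re h
    simp [hre] at this
    linarith
  have e : Complex.Gamma (w + 1 + 1) = (w + 1) * (w * Complex.Gamma w) := by
    rw [Complex.Gamma_add_one _ hw1, Complex.Gamma_add_one _ hw0]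
  have b : ‖Complex.Gamma (w + 1 + 1)‖ ≤ Real.Gamma (σ + 2) := by
    have := aux_norm_Gamma_le (z := w + 1 + 1) (by simp [hre]; linarith)
    simpa [hre, add_assoc, one_add_one_eq_two] using this
  rw [e, norm_mul, norm_mul, ← mul_assoc] at b
  have n0 : ‖w‖ ^ 2 = σ ^ 2 + v ^ 2 := by
    rw [Complex.sq_norm, Complex.normSq_apply, hre, him]; ring
  have n1 : ‖w + 1‖ ^ 2 = (σ + 1) ^ 2 + v ^ 2 := by
    rw [Complex.sq_norm, Complex.normSq_apply]; simp [hre, him]; ring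
  have key : σ * (1 + v ^ 2) ≤ ‖w + 1‖ * ‖w‖ := by
    refine (sq_le_sq₀ (by positivity) (by positivity)).mp ?_
    rw [mul_pow, mul_pow, n0, n1]
    have a1 : σ ^ 2 * (1 + v ^ 2) ≤ σ ^ 2 + v ^ 2 := by
      have hσ : σ ^ 2 ≤ 1 := by nlinarith
      nlinarith [mul_le_mul_of_nonneg_right hσ (sq_nonneg v)]
    have a2 : 1 + v ^ 2 ≤ (σ + 1) ^ 2 + v ^ 2 := by nlinarith
    calc σ ^ 2 * (1 + v ^ 2) ^ 2 = (1 + v ^ 2) * (σ ^ 2 * (1 + v ^ 2)) := by ring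
      _ ≤ _ := by gcongr
  have hp : 0 < σ * (1 + v ^ 2) := by positivity
  rw [div_mul_eq_mul_div, ← div_eq_mul_inv, div_div, mul_comm (1 + v ^ 2), le_div_iff₀ hp, mul_comm]
  exact (mul_le_mul_of_nonneg_right key (norm_nonneg _)).trans b

lemma aux_cont {σ : ℝ} (h0 : 0 < σ) :
    Continuous fun v : ℝ => Complex.Gamma (σ + v * Complex.I) := by
  rw [continuous_iff_continuousAt]
  intro v
  have hd : DifferentiableAt ℂ Complex.Gamma (σ + v * Complex.I) := by
    apply Complex.differentiableAt_Gamma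
    intro m h
    have := congrArg Complex.re h
    simp at this
    have hm : (0 : ℝ) ≤ m := Nat.cast_nonneg m
    linarith
  exact ContinuousAt.comp (f := fun v : ℝ => ((σ : ℂ) + v * Complex.I)) hd.continuousAt
    (by fun_prop)

lemma aux_vert {σ : ℝ} (h0 : 0 < σ) (h1 : σ < 1) :
    Integrable fun v : ℝ => Complex.Gamma (σ + v * Complex.I) :=
  (integrable_inv_one_add_sq.const_mul (Real.Gamma (σ + 2) / σ)).mono'
    (aux_cont h0).aestronglyMeasurable (ae_of_all _ (aux_Gamma_bound h0 h1))

lemma aux_inv {σ x : ℝ} (h0 : 0 < σ) (h1 : σ < 1) (hx : 0 < x) :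
    ∫ v : ℝ, (x : ℂ) ^ (-((σ : ℂ) + v * Complex.I)) * Complex.Gamma (σ + v * Complex.I) =
      2 * (Real.pi : ℂ) * (Real.exp (-x) : ℝ) := by
  have hm : ∀ v : ℝ, mellin (fun x : ℝ => ((Real.exp (-x) : ℝ) : ℂ)) (σ + v * Complex.I) =
      Complex.Gamma (σ + v * Complex.I) := by
    intro v
    rw [Complex.Gamma_eq_integral (by simpa using h0), Complex.GammaIntegral_eq_mellin]
  have h := mellinInv_mellin_eq σ (fun x : ℝ => ((Real.exp (-x) : ℝ) : ℂ)) hx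
    (by
      have := Complex.GammaIntegral_convergent (s := σ) (by simpa using h0)
      simpa [MellinConvergent, mul_comm] using this)
    (by
      unfold Complex.VerticalIntegrable
      simp_rw [hm]
      exact aux_vert h0 h1)
    (by fun_prop)
  rw [mellinInv] at h
  simp_rw [hm, smul_eq_mul] at h
  rw [← h, Complex.real_smul]
  generalize (∫ v : ℝ, (x : ℂ) ^ (-((σ : ℂ) + v * Complex.I)) *
    Complex.Gamma (σ + v * Complex.I)) = J
  have : (Real.pi : ℂ) ≠ 0 := by exact_mod_cast Real.pi_ne_zero
  push_cast
  field_simp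

lemma aux_int_s14 {σ x : ℝ} (h0 : 0 < σ) (h1 : σ < 1) (hx : 0 < x) :
    Integrable fun v : ℝ =>
      (x : ℂ) ^ (-((σ : ℂ) + v * Complex.I)) * Complex.Gamma (σ + v * Complex.I) := by
  refine (aux_vert h0 h1).bdd_mul (c := x ^ (-σ)) ?_ (ae_of_all _ fun v => ?_)
  · have : (x : ℂ) ≠ 0 := by exact_mod_cast hx.ne'
    apply Continuous.aestronglyMeasurable
    exact Continuous.const_cpow (by fun_prop) (Or.inl this)
  · rw [Complex.norm_cpow_eq_rpow_re_of_pos hx]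
    simp

lemma aux_point {X c : ℝ} (hX : X ≠ 0) (hc : c < 1) (u : ℝ) :
    Complex.Gamma (1 - ((c : ℂ) + u * Complex.I)) /
          Complex.Gamma (1 - ((c : ℂ) + u * Complex.I) / 2) *
        ((|X| : ℝ) : ℂ) ^ (((c : ℂ) + u * Complex.I) - 1) =
    (1 / (2 * (Real.sqrt Real.pi : ℂ))) *
      (((X ^ 2 / 4 : ℝ) : ℂ) ^ (-((((1 - c) / 2 : ℝ) : ℂ) + ((u * (-1 / 2) : ℝ) : ℂ) * Complex.I)) *
        Complex.Gamma ((((1 - c) / 2 : ℝ) : ℂ) + ((u * (-1 / 2) : ℝ) : ℂ) * Complex.I)) := by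
  set w : ℂ := (((1 - c) / 2 : ℝ) : ℂ) + ((u * (-1 / 2) : ℝ) : ℂ) * Complex.I with hw
  have e1 : 1 - ((c : ℂ) + u * Complex.I) = 2 * w := by rw [hw]; push_cast; ring
  have e2 : 1 - ((c : ℂ) + u * Complex.I) / 2 = w + 1 / 2 := by rw [hw]; push_cast; ring
  have e3 : ((c : ℂ) + u * Complex.I) - 1 = -(2 * w) := by rw [hw]; push_cast; ring
  rw [e1, e2, e3]
  have hwre : 0 < w.re := by simp [hw]; linarith
  have hG : Complex.Gamma (w + 1 / 2) ≠ 0 :=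
    Complex.Gamma_ne_zero_of_re_pos (by simp; linarith)
  have hd := Complex.Gamma_mul_Gamma_add_half w
  have hA : 0 < |X| := abs_pos.mpr hX
  have hs : (Real.sqrt Real.pi : ℂ) ≠ 0 := by
    exact_mod_cast (Real.sqrt_pos.mpr Real.pi_pos).ne'
  have hlog : Real.log (X ^ 2 / 4) = 2 * Real.log |X| - 2 * Real.log 2 := by
    rw [Real.log_div (by positivity) (by norm_num), Real.log_pow, Real.log_abs,
      show (4 : ℝ) = 2 ^ 2 by norm_num, Real.log_pow]
    norm_num
  have p1 : ((X ^ 2 / 4 : ℝ) : ℂ) ^ (-w) =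
      ((|X| : ℝ) : ℂ) ^ (-(2 * w)) * Complex.exp (Real.log 2 * (2 * w)) := by
    have hne : ((X ^ 2 / 4 : ℝ) : ℂ) ≠ 0 := by
      exact_mod_cast (show X ^ 2 / 4 ≠ 0 by positivity)
    rw [Complex.cpow_def_of_ne_zero hne,
      Complex.cpow_def_of_ne_zero (by exact_mod_cast hA.ne'), ← Complex.ofReal_log (by positivity),
      ← Complex.ofReal_log hA.le, hlog, ← Complex.exp_add]
    congr 1
    push_cast
    ring
  have p2 : (2 : ℂ) ^ (1 - 2 * w) * Complex.exp (Real.log 2 * (2 * w)) = 2 := by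
    have : (2 : ℂ) = ((2 : ℝ) : ℂ) := by norm_num
    rw [Complex.cpow_def_of_ne_zero two_ne_zero, this, ← Complex.ofReal_log (by norm_num),
      ← Complex.exp_add, ← this,
      show (Real.log 2 : ℂ) * (1 - 2 * w) + Real.log 2 * (2 * w) = (Real.log 2 : ℂ) by ring,
      ← Complex.ofReal_exp, Real.exp_log (by norm_num)]
    norm_num
  rw [p1, div_mul_eq_mul_div, div_eq_iff hG]
  set P := ((|X| : ℝ) : ℂ) ^ (-(2 * w))
  set Q := Complex.exp (Real.log 2 * (2 * w))
  calc Complex.Gamma (2 * w) * P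
      = 1 / (2 * (Real.sqrt Real.pi : ℂ)) * (P * Q) *
        (Complex.Gamma (2 * w) * 2 ^ (1 - 2 * w) * (Real.sqrt Real.pi : ℂ)) := by
        field_simp
        linear_combination (-1 : ℂ) * P * Complex.Gamma (2 * w) * p2
    _ = _ := by rw [← hd]; ring

/-- The Mellin–Barnes representation of the Green function for `α = 2`
evaluates to the Gaussian (heat) kernel: for `X ≠ 0` and `c ∈ (0,1)`, with
`s = c + iu`, the function `u ↦ (Γ(1-s)/Γ(1-s/2)) |X|^(s-1)` is integrable on `ℝ` and
`(1/2)(1/(2π)) ∫_ℝ (Γ(1-s)/Γ(1-s/2)) |X|^(s-1) du = (1/(2√π)) e^(-X²/4)`. -/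
theorem stmt_14 (X c : ℝ) (hX : X ≠ 0) (hc : c ∈ Set.Ioo (0 : ℝ) 1) :
    Integrable (fun u : ℝ =>
      Complex.Gamma (1 - ((c : ℂ) + u * Complex.I)) /
          Complex.Gamma (1 - ((c : ℂ) + u * Complex.I) / 2) *
        ((|X| : ℝ) : ℂ) ^ (((c : ℂ) + u * Complex.I) - 1)) ∧
    (1 / 2 : ℂ) * (1 / (2 * (Real.pi : ℂ))) *
        ∫ u : ℝ,
          Complex.Gamma (1 - ((c : ℂ) + u * Complex.I)) /
              Complex.Gamma (1 - ((c : ℂ) + u * Complex.I) / 2) *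
            ((|X| : ℝ) : ℂ) ^ (((c : ℂ) + u * Complex.I) - 1) =
      ((1 / (2 * Real.sqrt Real.pi) * Real.exp (-(X ^ 2) / 4) : ℝ) : ℂ) := by
  have h0 : 0 < (1 - c) / 2 := by linarith [hc.2]
  have h1 : (1 - c) / 2 < 1 := by linarith [hc.1]
  have hx : 0 < X ^ 2 / 4 := by positivity
  simp_rw [aux_point hX hc.2]
  constructor
  · exact ((aux_int_s14 h0 h1 hx).comp_mul_right' (R := -1 / 2) (by norm_num)).const_mul _
  · rw [integral_const_mul, Measure.integral_comp_mul_right (fun v : ℝ =>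
      ((X ^ 2 / 4 : ℝ) : ℂ) ^ (-((((1 - c) / 2 : ℝ) : ℂ) + (v : ℂ) * Complex.I)) *
        Complex.Gamma ((((1 - c) / 2 : ℝ) : ℂ) + (v : ℂ) * Complex.I)) (-1 / 2),
      aux_inv h0 h1 hx]
    have hpi : (Real.pi : ℂ) ≠ 0 := by exact_mod_cast Real.pi_ne_zero
    have hs : (Real.sqrt Real.pi : ℂ) ≠ 0 := by
      exact_mod_cast (Real.sqrt_pos.mpr Real.pi_pos).ne'
    have ha : |((-1 / 2 : ℝ))⁻¹| = 2 := by norm_num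
    rw [ha, Complex.real_smul, neg_div]
    push_cast
    field_simp
end

section
/- Let α ∈ (1, 2] and X > 0. For every c ∈ (0, 1), writing s = c + iu, the function u ↦ (Γ(1 − s)/Γ(1 − s/α)) · X^{s−1} is Lebesgue integrable on ℝ, and the value (1/(2π)) ∫_ℝ (Γ(1 − s)/Γ(1 − s/α)) · X^{s−1} du is the same for all c ∈ (0, 1); i.e. the Mellin–Barnes representation of the maximally negatively skewed stable Green function on the positive half-axis is independent of the choice of vertical line 0 < c < 1. -/
open MeasureTheory

namespace MBAux

open Complex Filter Topology

theorem shift_line (f : ℂ → ℂ) (a b : ℝ) (B : ℝ → ℝ)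
    (hB1 : Tendsto B atTop (𝓝 0)) (hB2 : Tendsto B atBot (𝓝 0)) (hab : a ≤ b)
    (hf : DifferentiableOn ℂ f {z | z.re ∈ Set.Icc a b})
    (hb : ∀ x ∈ Set.Icc a b, ∀ u : ℝ, ‖f (x + u * I)‖ ≤ B u)
    (hia : Integrable (fun u : ℝ => f (a + u * I))) (hib : Integrable (fun u : ℝ => f (b + u * I))) :
    ∫ u : ℝ, f (a + u * I) = ∫ u : ℝ, f (b + u * I) := by
  have hR : ∀ T : ℝ, (∫ x in a..b, f (x + (-T : ℝ) * I)) - (∫ x in a..b, f (x + T * I)) +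
      I • (∫ y in (-T)..T, f (b + y * I)) - I • (∫ y in (-T)..T, f (a + y * I)) = 0 := by
    intro T
    have := Complex.integral_boundary_rect_eq_zero_of_differentiableOn f (⟨a, -T⟩ : ℂ) ⟨b, T⟩
      (hf.mono (by
        intro z hz
        simp only [mem_reProdIm, Set.uIcc_of_le hab] at hz
        exact hz.1))
    simpa using this
  have e1 : Tendsto (fun T : ℝ => B T * |b - a|) atTop (𝓝 0) := by
    simpa using hB1.mul_const (|b - a|)
  have e2 : Tendsto (fun T : ℝ => B (-T) * |b - a|) atTop (𝓝 0) := by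
    simpa using (hB2.comp tendsto_neg_atTop_atBot).mul_const (|b - a|)
  have hz1 : Tendsto (fun T : ℝ => ∫ x in a..b, f (x + (-T : ℝ) * I)) atTop (𝓝 0) := by
    refine squeeze_zero_norm (fun T => ?_) e2
    apply intervalIntegral.norm_integral_le_of_norm_le_const
    intro x hx
    rw [Set.uIoc_of_le hab] at hx
    simpa using hb x ⟨hx.1.le, hx.2⟩ (-T)
  have hz2 : Tendsto (fun T : ℝ => ∫ x in a..b, f (x + T * I)) atTop (𝓝 0) := by
    refine squeeze_zero_norm (fun T => ?_) e1
    apply intervalIntegral.norm_integral_le_of_norm_le_const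
    intro x hx
    rw [Set.uIoc_of_le hab] at hx
    simpa using hb x ⟨hx.1.le, hx.2⟩ T
  have hv1 := intervalIntegral_tendsto_integral hia tendsto_neg_atTop_atBot tendsto_id
  have hv2 := intervalIntegral_tendsto_integral hib tendsto_neg_atTop_atBot tendsto_id
  have hl := ((hz1.sub hz2).add (hv2.const_smul I)).sub (hv1.const_smul I)
  have h0 := tendsto_nhds_unique hl ((tendsto_congr hR).mpr tendsto_const_nhds)
  have : I * ((∫ u : ℝ, f (b + u * I)) - ∫ u : ℝ, f (a + u * I)) = 0 := by
    simp only [smul_eq_mul] at h0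
    linear_combination h0
  have := (mul_eq_zero.mp this).resolve_left I_ne_zero
  exact (sub_eq_zero.mp this).symm

theorem exp_subst_integrable (x c : ℝ) (hx : 0 < x) (hc : 0 < c) :
    Integrable (fun u : ℝ => Real.exp (x * u - c * Real.exp u)) := by
  have h0 : IntegrableOn (fun t : ℝ => t ^ (x - 1) * Real.exp (-c * t)) (Set.Ioi 0) := by
    have := integrableOn_rpow_mul_exp_neg_mul_rpow (s := x - 1) (p := 1) (b := c)
      (by linarith) (by norm_num) hc
    simpa using this
  have := integrableOn_image_iff_integrableOn_abs_deriv_smul (f := Real.exp) (f' := Real.exp)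
    (s := Set.univ) MeasurableSet.univ (fun u _ => (Real.hasDerivAt_exp u).hasDerivWithinAt)
    Real.exp_injective.injOn (fun t : ℝ => t ^ (x - 1) * Real.exp (-c * t))
  rw [Set.image_univ, Real.range_exp, integrableOn_univ] at this
  refine (this.mp h0).congr (Eventually.of_forall fun u => ?_)
  simp only [smul_eq_mul, abs_of_pos (Real.exp_pos u)]
  rw [← Real.exp_mul, ← Real.exp_add, ← Real.exp_add]
  congr 1; ring

theorem gamma_subst (z : ℂ) (hz : 0 < z.re) :
    Complex.Gamma z = ∫ u : ℝ, Complex.exp (z * u - Complex.exp u) := by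
  rw [Complex.Gamma_eq_integral hz, Complex.GammaIntegral]
  have := integral_image_eq_integral_abs_deriv_smul (f := Real.exp) (f' := Real.exp)
    (s := Set.univ) MeasurableSet.univ (fun u _ => (Real.hasDerivAt_exp u).hasDerivWithinAt)
    Real.exp_injective.injOn (fun t : ℝ => ((Real.exp (-t) : ℝ) : ℂ) * (t : ℂ) ^ (z - 1))
  rw [Set.image_univ, Real.range_exp, setIntegral_univ] at this
  rw [this]
  congr 1
  ext u
  simp only [real_smul, abs_of_pos (Real.exp_pos u)]
  rw [Complex.cpow_def_of_ne_zero (by exact_mod_cast (Real.exp_pos u).ne'), ← Complex.ofReal_log (Real.exp_pos u).le, Real.log_exp]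
  push_cast
  rw [← Complex.exp_add, ← Complex.exp_add]
  congr 1; ring

theorem gamma_bd_neg (θ : ℝ) (h0 : 0 ≤ θ) (h : θ < Real.pi / 2) (z : ℂ) (hz : 0 < z.re) :
    ‖Complex.Gamma z‖ ≤ (∫ u : ℝ, Real.exp (z.re * u - Real.cos θ * Real.exp u)) *
      Real.exp (θ * z.im) := by
  have hc : 0 < Real.cos θ := Real.cos_pos_of_mem_Ioo ⟨by linarith [Real.pi_pos], h⟩
  set f : ℂ → ℂ := fun s => Complex.exp (z * (-I * s) - Complex.exp (-I * s)) with hf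
  have hnorm : ∀ x u : ℝ, ‖f (x + u * I)‖ =
      Real.exp (z.re * u - Real.cos x * Real.exp u) * Real.exp (x * z.im) := by
    intro x u
    have : -I * (x + u * I) = u + (-x : ℝ) * I := by
      push_cast
      linear_combination (-(u : ℂ)) * I_sq
    simp only [hf]
    rw [this, Complex.norm_exp, ← Real.exp_add]
    congr 1
    simp [Complex.exp_re]
    ring
  have hle : ∀ x ∈ Set.Icc 0 θ, ∀ u : ℝ, ‖f (x + u * I)‖ ≤
      Real.exp (z.re * u - Real.cos θ * Real.exp u) * Real.exp (θ * |z.im|) := by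
    intro x hx u
    rw [hnorm]
    have h1 : Real.cos θ ≤ Real.cos x :=
      Real.cos_le_cos_of_nonneg_of_le_pi hx.1 (by linarith) hx.2
    have h2 : x * z.im ≤ θ * |z.im| :=
      (mul_le_mul_of_nonneg_left (le_abs_self _) hx.1).trans
        (mul_le_mul_of_nonneg_right hx.2 (abs_nonneg _))
    gcongr
  have hfd : Differentiable ℂ f := by
    simp only [hf]; fun_prop
  have hint0 := exp_subst_integrable z.re (Real.cos θ) hz hc
  have hint : ∀ x ∈ Set.Icc 0 θ, Integrable (fun u : ℝ => f (x + u * I)) := by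
    intro x hx
    refine (hint0.mul_const (Real.exp (θ * |z.im|))).mono' ?_ (Eventually.of_forall (hle x hx))
    have : Continuous (fun u : ℝ => f (x + u * I)) := hfd.continuous.comp (by fun_prop)
    exact this.aestronglyMeasurable
  have hB1 : Tendsto (fun u : ℝ => Real.exp (z.re * u - Real.cos θ * Real.exp u)) atTop (𝓝 0) := by
    have := (tendsto_rpow_mul_exp_neg_mul_atTop_nhds_zero z.re (Real.cos θ) hc).comp
      Real.tendsto_exp_atTop
    refine this.congr fun u => ?_
    simp only [Function.comp]
    rw [← Real.exp_mul, ← Real.exp_add]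
    congr 1; ring
  have hB2 : Tendsto (fun u : ℝ => Real.exp (z.re * u - Real.cos θ * Real.exp u)) atBot (𝓝 0) := by
    have h1 : Tendsto (fun u : ℝ => Real.exp (z.re * u)) atBot (𝓝 0) :=
      Real.tendsto_exp_atBot.comp (tendsto_id.const_mul_atBot hz)
    refine squeeze_zero (fun u => (Real.exp_pos _).le) (fun u => ?_) h1
    apply Real.exp_le_exp.mpr
    have := mul_pos hc (Real.exp_pos u)
    linarith
  have h0m : (0 : ℝ) ∈ Set.Icc 0 θ := ⟨le_rfl, h0⟩
  have hθm : θ ∈ Set.Icc 0 θ := ⟨h0, le_rfl⟩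
  have key := shift_line f 0 θ
    (fun u => Real.exp (z.re * u - Real.cos θ * Real.exp u) * Real.exp (θ * |z.im|))
    (by simpa using hB1.mul_const _) (by simpa using hB2.mul_const _) h0 hfd.differentiableOn hle
    (hint 0 h0m) (hint θ hθm)
  have hg : Complex.Gamma z = ∫ u : ℝ, f ((0 : ℝ) + u * I) := by
    rw [gamma_subst z hz]
    congr 1
    ext u
    simp only [hf]
    have : -I * ((0 : ℝ) + u * I) = u := by
      push_cast
      linear_combination (-(u : ℂ)) * I_sq
    rw [this]
  rw [hg, key, ← integral_mul_const]
  refine (norm_integral_le_integral_norm _).trans_eq ?_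
  simp only [hnorm]

theorem gamma_bd (θ : ℝ) (h0 : 0 ≤ θ) (h : θ < Real.pi / 2) (a b : ℝ) (ha : 0 < a) :
    ∃ C, 0 ≤ C ∧ ∀ z : ℂ, z.re ∈ Set.Icc a b →
      ‖Complex.Gamma z‖ ≤ C * Real.exp (-θ * |z.im|) := by
  have hc : 0 < Real.cos θ := Real.cos_pos_of_mem_Ioo ⟨by linarith [Real.pi_pos], h⟩
  by_cases hab : a ≤ b
  swap
  · exact ⟨0, le_rfl, fun z hz => absurd (hz.1.trans hz.2) hab⟩
  have ia := exp_subst_integrable a (Real.cos θ) ha hc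
  have ib := exp_subst_integrable b (Real.cos θ) (ha.trans_le hab) hc
  have hC : ∀ x ∈ Set.Icc a b, (∫ u : ℝ, Real.exp (x * u - Real.cos θ * Real.exp u)) ≤
      ∫ u : ℝ, (Real.exp (a * u - Real.cos θ * Real.exp u) +
        Real.exp (b * u - Real.cos θ * Real.exp u)) := by
    intro x hx
    refine integral_mono (exp_subst_integrable x _ (ha.trans_le hx.1) hc) (ia.add ib) fun u => ?_
    simp only
    rcases le_total 0 u with hu | hu
    · have : Real.exp (x * u - Real.cos θ * Real.exp u) ≤
          Real.exp (b * u - Real.cos θ * Real.exp u) := by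
        have := hx.2
        gcongr
      linarith [Real.exp_pos (a * u - Real.cos θ * Real.exp u)]
    · have : Real.exp (x * u - Real.cos θ * Real.exp u) ≤
          Real.exp (a * u - Real.cos θ * Real.exp u) := by
        have := mul_le_mul_of_nonpos_right hx.1 hu
        gcongr
      linarith [Real.exp_pos (b * u - Real.cos θ * Real.exp u)]
  have main : ∀ z : ℂ, z.re ∈ Set.Icc a b → z.im ≤ 0 → ‖Complex.Gamma z‖ ≤
      (∫ u : ℝ, (Real.exp (a * u - Real.cos θ * Real.exp u) +
        Real.exp (b * u - Real.cos θ * Real.exp u))) * Real.exp (-θ * |z.im|) := by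
    intro z hz hi
    refine (gamma_bd_neg θ h0 h z (ha.trans_le hz.1)).trans ?_
    rw [abs_of_nonpos hi, neg_mul_neg]
    exact mul_le_mul_of_nonneg_right (hC _ hz) (Real.exp_pos _).le
  refine ⟨∫ u : ℝ, (Real.exp (a * u - Real.cos θ * Real.exp u) +
        Real.exp (b * u - Real.cos θ * Real.exp u)), ?_, fun z hz => ?_⟩
  · exact integral_nonneg fun u => by positivity
  rcases le_total z.im 0 with hi | hi
  · exact main z hz hi
  · have := main (starRingEnd ℂ z) (by simpa using hz) (by simpa using hi)
    rw [Complex.Gamma_conj] at this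
    simpa using this

theorem sin_bd (z : ℂ) : ‖Complex.sin z‖ ≤ Real.exp |z.im| := by
  have h1 : ‖Complex.exp (-z * I)‖ ≤ Real.exp |z.im| := by
    rw [Complex.norm_exp]; simpa using le_abs_self z.im
  have h2 : ‖Complex.exp (z * I)‖ ≤ Real.exp |z.im| := by
    rw [Complex.norm_exp]; simpa using neg_le_abs z.im
  have := norm_sub_le (Complex.exp (-z * I)) (Complex.exp (z * I))
  rw [Complex.sin, norm_div, norm_mul]
  simp
  simp at this h1 h2
  linarith

theorem int_exp (δ : ℝ) (hδ : 0 < δ) : Integrable (fun u : ℝ => Real.exp (-δ * |u|)) := by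
  rw [← integrableOn_univ, ← Set.Iic_union_Ioi (a := (0 : ℝ))]
  refine IntegrableOn.union ?_ ?_
  · refine (integrableOn_exp_mul_Iic hδ 0).congr_fun (fun u hu => ?_) measurableSet_Iic
    simp only [abs_of_nonpos (Set.mem_Iic.mp hu), neg_mul_neg]
  · refine (integrableOn_exp_mul_Ioi (neg_lt_zero.mpr hδ) 0).congr_fun (fun u hu => ?_)
      measurableSet_Ioi
    simp only [abs_of_pos (Set.mem_Ioi.mp hu)]

theorem recip_gamma (w : ℂ) (h0 : 0 < w.re) (h1 : w.re < 1) :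
    ‖(Complex.Gamma (1 - w))⁻¹‖ ≤ ‖Complex.Gamma w‖ * Real.exp (Real.pi * |w.im|) := by
  have hg : Complex.Gamma w ≠ 0 := Complex.Gamma_ne_zero_of_re_pos h0
  have hg' : Complex.Gamma (1 - w) ≠ 0 := Complex.Gamma_ne_zero_of_re_pos (by simpa using h1)
  have hr := Complex.Gamma_mul_Gamma_one_sub w
  have hs : Complex.sin (Real.pi * w) ≠ 0 := by
    intro hs
    rw [hs, div_zero] at hr
    exact mul_ne_zero hg hg' hr
  have hpi : (Real.pi : ℂ) ≠ 0 := by exact_mod_cast Real.pi_ne_zero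
  have he : (Complex.Gamma (1 - w))⁻¹ = Complex.Gamma w * (Complex.sin (Real.pi * w) / Real.pi) := by
    rw [eq_div_iff hs] at hr
    rw [← one_div, div_eq_iff hg']
    rw [← mul_div_assoc, div_mul_eq_mul_div, eq_div_iff hpi]
    linear_combination -hr
  rw [he, norm_mul, norm_div]
  have h2 := sin_bd (Real.pi * w)
  have him : |((Real.pi : ℂ) * w).im| = Real.pi * |w.im| := by
    simp [abs_mul, abs_of_pos Real.pi_pos]
  rw [him] at h2
  have hp : ‖(Real.pi : ℂ)‖ = Real.pi := by simp [abs_of_pos Real.pi_pos]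
  rw [hp]
  gcongr
  refine (div_le_self (norm_nonneg _) ?_).trans h2
  linarith [Real.pi_gt_three]

theorem integrand_bd (α X : ℝ) (hα : 1 < α) (hX : 0 < X) (a b : ℝ)
    (ha : 0 < a) (hb : b < 1) :
    ∃ C δ : ℝ, 0 < δ ∧ ∀ x ∈ Set.Icc a b, ∀ u : ℝ,
      ‖Complex.Gamma (1 - ((x : ℂ) + u * Complex.I)) /
            Complex.Gamma (1 - ((x : ℂ) + u * Complex.I) / (α : ℂ)) *
          (X : ℂ) ^ (((x : ℂ) + u * Complex.I) - 1)‖ ≤ C * Real.exp (-δ * |u|) := by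
  have hα0 : 0 < α := by linarith
  have hpi := Real.pi_pos
  obtain ⟨θ, hθ1, hθ2⟩ : ∃ θ, Real.pi / (α + 1) < θ ∧ θ < Real.pi / 2 :=
    exists_between (by gcongr; linarith)
  have hθ0 : 0 < θ := lt_trans (by positivity) hθ1
  obtain ⟨C1, hC1, h1⟩ := gamma_bd θ hθ0.le hθ2 (1 - b) (1 - a) (by linarith)
  obtain ⟨C2, hC2, h2⟩ := gamma_bd θ hθ0.le hθ2 (a / α) (b / α) (by positivity)
  refine ⟨C1 * C2 * (X ^ (a - 1) + X ^ (b - 1)), (θ * (α + 1) - Real.pi) / α, ?_, ?_⟩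
  · rw [div_lt_iff₀ (by linarith)] at hθ1
    exact div_pos (by linarith) hα0
  intro x hx u
  have hre : (((x : ℂ) + u * I) / (α : ℂ)).re = x / α := by
    rw [Complex.div_ofReal_re]; simp
  have him : (((x : ℂ) + u * I) / (α : ℂ)).im = u / α := by
    rw [Complex.div_ofReal_im]; simp
  have hx0 : 0 < x := ha.trans_le hx.1
  have hx1 : x < 1 := hx.2.trans_lt hb
  have g1 := h1 (1 - ((x : ℂ) + u * I)) (by
    simp only [sub_re, one_re, add_re, ofReal_re, mul_re, I_re, ofReal_im, I_im]
    constructor <;> linarith [hx.1, hx.2])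
  have g2 := h2 (((x : ℂ) + u * I) / (α : ℂ)) (by
    rw [hre]
    exact ⟨by gcongr; exact hx.1, by gcongr; exact hx.2⟩)
  have g3 := recip_gamma (((x : ℂ) + u * I) / (α : ℂ)) (by rw [hre]; positivity)
    (by rw [hre, div_lt_one hα0]; linarith)
  have g4 : ‖(X : ℂ) ^ (((x : ℂ) + u * I) - 1)‖ ≤ X ^ (a - 1) + X ^ (b - 1) := by
    rw [Complex.norm_cpow_eq_rpow_re_of_pos hX]
    have hr : (((x : ℂ) + u * I) - 1).re = x - 1 := by simp
    rw [hr]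
    have pa := Real.rpow_pos_of_pos hX (a - 1)
    have pb := Real.rpow_pos_of_pos hX (b - 1)
    rcases le_total 1 X with h | h
    · have := Real.rpow_le_rpow_of_exponent_le h (sub_le_sub_right hx.2 1)
      linarith
    · have := Real.rpow_le_rpow_of_exponent_ge hX h (sub_le_sub_right hx.1 1)
      linarith
  have i1 : |(1 - ((x : ℂ) + u * I)).im| = |u| := by simp
  have i2 : |(((x : ℂ) + u * I) / (α : ℂ)).im| = |u| / α := by
    rw [him, abs_div, abs_of_pos hα0]
  rw [i1] at g1
  rw [i2] at g2 g3
  rw [norm_mul, div_eq_mul_inv, norm_mul]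
  calc _ ≤ (C1 * Real.exp (-θ * |u|)) * ((C2 * Real.exp (-θ * (|u| / α))) *
        Real.exp (Real.pi * (|u| / α))) * (X ^ (a - 1) + X ^ (b - 1)) := by
        gcongr
        exact g3.trans (by gcongr)
    _ = C1 * C2 * (X ^ (a - 1) + X ^ (b - 1)) * (Real.exp (-θ * |u|) *
        Real.exp (-θ * (|u| / α)) * Real.exp (Real.pi * (|u| / α))) := by ring
    _ = _ := by
        rw [← Real.exp_add, ← Real.exp_add]
        congr 2
        field_simp
        ring

theorem integrand_diff (α X : ℝ) (hα : 1 < α) (hX : 0 < X) (z : ℂ) (hz : z.re < 1) :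
    DifferentiableAt ℂ (fun s : ℂ => Complex.Gamma (1 - s) / Complex.Gamma (1 - s / (α : ℂ)) *
      (X : ℂ) ^ (s - 1)) z := by
  have hX' : (X : ℂ) ≠ 0 := by exact_mod_cast hX.ne'
  have h1 : DifferentiableAt ℂ (fun s : ℂ => Complex.Gamma (1 - s)) z := by
    refine DifferentiableAt.comp (g := Complex.Gamma) z (Complex.differentiableAt_Gamma _ ?_)
      (by fun_prop)
    intro m hm
    have := congrArg Complex.re hm
    simp at this
    have : (0 : ℝ) ≤ m := Nat.cast_nonneg m
    linarith
  have h2 : DifferentiableAt ℂ (fun s : ℂ => (Complex.Gamma (1 - s / (α : ℂ)))⁻¹) z :=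
    DifferentiableAt.comp (g := fun s => (Complex.Gamma s)⁻¹) z
      (Complex.differentiable_one_div_Gamma _) (by fun_prop)
  have h3 : DifferentiableAt ℂ (fun s : ℂ => (X : ℂ) ^ (s - 1)) z :=
    DifferentiableAt.const_cpow (by fun_prop) (Or.inl hX')
  simp only [div_eq_mul_inv (Complex.Gamma _)]
  exact (h1.mul h2).mul h3

end MBAux

/-- The Mellin–Barnes representation of the maximally negatively skewed
stable Green function on the positive half-axis is independent of the choice of
vertical line `0 < c < 1`: for `α ∈ (1,2]` and `X > 0`, with `s = c + iu`, the
function `u ↦ (Γ(1-s)/Γ(1-s/α)) X^(s-1)` is integrable on `ℝ` for every `c ∈ (0,1)`,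
and `(1/(2π)) ∫_ℝ (Γ(1-s)/Γ(1-s/α)) X^(s-1) du` has the same value for all
`c ∈ (0,1)`. -/
theorem stmt_15 (α X : ℝ) (hα : α ∈ Set.Ioc (1 : ℝ) 2) (hX : 0 < X) :
    (∀ c ∈ Set.Ioo (0 : ℝ) 1,
      Integrable (fun u : ℝ =>
        Complex.Gamma (1 - ((c : ℂ) + u * Complex.I)) /
            Complex.Gamma (1 - ((c : ℂ) + u * Complex.I) / (α : ℂ)) *
          (X : ℂ) ^ (((c : ℂ) + u * Complex.I) - 1))) ∧
    ∀ c ∈ Set.Ioo (0 : ℝ) 1, ∀ c' ∈ Set.Ioo (0 : ℝ) 1,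
      (1 / (2 * (Real.pi : ℂ))) *
          ∫ u : ℝ,
            Complex.Gamma (1 - ((c : ℂ) + u * Complex.I)) /
                Complex.Gamma (1 - ((c : ℂ) + u * Complex.I) / (α : ℂ)) *
              (X : ℂ) ^ (((c : ℂ) + u * Complex.I) - 1) =
        (1 / (2 * (Real.pi : ℂ))) *
          ∫ u : ℝ,
            Complex.Gamma (1 - ((c' : ℂ) + u * Complex.I)) /
                Complex.Gamma (1 - ((c' : ℂ) + u * Complex.I) / (α : ℂ)) *
              (X : ℂ) ^ (((c' : ℂ) + u * Complex.I) - 1) := by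
  have hα1 := hα.1
  have hint : ∀ c ∈ Set.Ioo (0 : ℝ) 1,
      Integrable (fun u : ℝ =>
        Complex.Gamma (1 - ((c : ℂ) + u * Complex.I)) /
            Complex.Gamma (1 - ((c : ℂ) + u * Complex.I) / (α : ℂ)) *
          (X : ℂ) ^ (((c : ℂ) + u * Complex.I) - 1)) := by
    intro c hc
    obtain ⟨C, δ, hδ, hb⟩ := MBAux.integrand_bd α X hα1 hX c c hc.1 hc.2
    refine ((MBAux.int_exp δ hδ).const_mul C).mono' ?_
      (Filter.Eventually.of_forall (hb c ⟨le_rfl, le_rfl⟩))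
    refine Continuous.aestronglyMeasurable ?_
    rw [continuous_iff_continuousAt]
    intro u
    exact ContinuousAt.comp (f := fun u : ℝ => (c : ℂ) + u * Complex.I)
      (MBAux.integrand_diff α X hα1 hX _ (by simpa using hc.2)).continuousAt
      (by fun_prop)
  have hle : ∀ c ∈ Set.Ioo (0 : ℝ) 1, ∀ c' ∈ Set.Ioo (0 : ℝ) 1, c ≤ c' →
          ∫ u : ℝ,
            Complex.Gamma (1 - ((c : ℂ) + u * Complex.I)) /
                Complex.Gamma (1 - ((c : ℂ) + u * Complex.I) / (α : ℂ)) *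
              (X : ℂ) ^ (((c : ℂ) + u * Complex.I) - 1) =
          ∫ u : ℝ,
            Complex.Gamma (1 - ((c' : ℂ) + u * Complex.I)) /
                Complex.Gamma (1 - ((c' : ℂ) + u * Complex.I) / (α : ℂ)) *
              (X : ℂ) ^ (((c' : ℂ) + u * Complex.I) - 1) := by
    intro c hc c' hc' hcc
    obtain ⟨C, δ, hδ, hb⟩ := MBAux.integrand_bd α X hα1 hX c c' hc.1 hc'.2
    have hB : ∀ l : Filter ℝ, Filter.Tendsto (fun T : ℝ => |T|) l Filter.atTop →
        Filter.Tendsto (fun T : ℝ => C * Real.exp (-δ * |T|)) l (nhds 0) := by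
      intro l hl
      have h1 : Filter.Tendsto (fun T : ℝ => Real.exp (-δ * |T|)) l (nhds 0) :=
        Real.tendsto_exp_atBot.comp (hl.const_mul_atTop_of_neg (by linarith))
      simpa using h1.const_mul C
    exact MBAux.shift_line (fun s : ℂ => Complex.Gamma (1 - s) / Complex.Gamma (1 - s / (α : ℂ)) *
      (X : ℂ) ^ (s - 1)) c c' (fun u => C * Real.exp (-δ * |u|))
      (hB _ Filter.tendsto_abs_atTop_atTop) (hB _ Filter.tendsto_abs_atBot_atTop) hcc
      (fun z hz => (MBAux.integrand_diff α X hα1 hX z (hz.2.trans_lt hc'.2)).differentiableWithinAt)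
      hb (hint c hc) (hint c' hc')
  refine ⟨hint, fun c hc c' hc' => ?_⟩
  congr 1
  rcases le_total c c' with h | h
  · exact hle c hc c' hc' h
  · exact (hle c' hc' c hc h).symm
end
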